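/- arXiv:1704.06388 — 3 statements merged into one kernel-verified Lean document; each statement's English description precedes it below -/
import Mathlib

section
/- Let Z be a standard normal random variable, let m ≠ 0 and c, y ∈ ℝ, and let R⁻ ≤ R⁺ be real numbers. Set r^± := (R^± − c)/m. Then E[ 1{R⁻ < mZ + c ≤ R⁺} · (y − (mZ + c)) ] = (y − c) · sgn(m) · (F_Z(r⁺) − F_Z(r⁻)) − |m| · (M_Z(r⁺) − M_Z(r⁻)). -/
open MeasureTheory ProbabilityTheory

/-- standard normal density `φ(t) = exp(−t²/2)/√(2π)` -/
noncomputable def stdPhi (t : ℝ) : ℝ := Real.exp (-t ^ 2 / 2) / Real.sqrt (2 * Real.pi)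

/-- standard normal cumulative distribution function `F_Z` -/
noncomputable def stdCDF (z : ℝ) : ℝ := ∫ t in Set.Iic z, stdPhi t

/-- first lower partial expectation `M_Z(z) = E[Z·1{Z < z}]` of a standard normal -/
noncomputable def stdM (z : ℝ) : ℝ := ∫ t in Set.Iio z, t * stdPhi t

theorem stdPhi_eq_gaussianPDFReal : stdPhi = gaussianPDFReal 0 1 := by
  ext t
  simp [stdPhi, gaussianPDFReal, div_eq_inv_mul]

theorem continuous_stdPhi : Continuous stdPhi := by
  unfold stdPhi
  fun_prop

theorem integrable_stdPhi : Integrable stdPhi := by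
  rw [stdPhi_eq_gaussianPDFReal]
  exact integrable_gaussianPDFReal 0 1

theorem integrable_mul_stdPhi : Integrable fun t => t * stdPhi t := by
  have h := (integrable_mul_exp_neg_mul_sq (b := 1 / 2) (by norm_num)).div_const √(2 * Real.pi)
  refine h.congr (.of_forall fun t => ?_)
  simp only [stdPhi, mul_div_assoc]
  ring_nf

theorem stdCDF_sub_stdCDF (a b : ℝ) : stdCDF b - stdCDF a = ∫ t in a..b, stdPhi t :=
  intervalIntegral.integral_Iic_sub_Iic integrable_stdPhi.integrableOn
    integrable_stdPhi.integrableOn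

theorem stdM_sub_stdM (a b : ℝ) : stdM b - stdM a = ∫ t in a..b, t * stdPhi t := by
  simp only [stdM, ← integral_Iic_eq_integral_Iio]
  exact intervalIntegral.integral_Iic_sub_Iic integrable_mul_stdPhi.integrableOn
    integrable_mul_stdPhi.integrableOn

theorem intervalIntegral_stdPhi_mul_sub_affine (m c y a b : ℝ) :
    ∫ t in a..b, stdPhi t * (y - (m * t + c))
      = (y - c) * (stdCDF b - stdCDF a) - m * (stdM b - stdM a) := by
  rw [stdCDF_sub_stdCDF, stdM_sub_stdM, ← intervalIntegral.integral_const_mul,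
    ← intervalIntegral.integral_const_mul, ← intervalIntegral.integral_sub
      (integrable_stdPhi.intervalIntegrable.const_mul _)
      (integrable_mul_stdPhi.intervalIntegrable.const_mul _)]
  congr 1
  ext t
  ring

theorem integral_indicator_comp_of_map_eq_gaussianReal
    {Ω : Type*} [MeasurableSpace Ω] {P : Measure Ω} {Z : Ω → ℝ} (hZm : Measurable Z)
    (hZ : P.map Z = gaussianReal 0 1) {s : Set ℝ} (hs : MeasurableSet s)
    {f : ℝ → ℝ} (hf : Measurable f) :
    ∫ ω, s.indicator f (Z ω) ∂P = ∫ t in s, stdPhi t * f t := by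
  rw [← integral_map hZm.aemeasurable (hf.indicator hs).aestronglyMeasurable, hZ,
    integral_gaussianReal_eq_integral_smul one_ne_zero, ← integral_indicator hs,
    stdPhi_eq_gaussianPDFReal]
  congr 1
  ext t
  by_cases ht : t ∈ s <;> simp [ht]

/-- **Truncated first moment of an affine Gaussian update.** For a standard normal `Z`,
`m ≠ 0`, and region `(R⁻, R⁺]` with standardized boundaries `r^± = (R^± − c)/m`,
`E[1{R⁻ < mZ + c ≤ R⁺}(y − (mZ + c))]
  = (y − c)·sgn(m)·(F_Z(r⁺) − F_Z(r⁻)) − |m|·(M_Z(r⁺) − M_Z(r⁻))`. -/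
theorem truncated_affine_gaussian_first_moment
    {Ω : Type*} [MeasurableSpace Ω] (P : Measure Ω) [IsProbabilityMeasure P]
    (Z : Ω → ℝ) (hZm : Measurable Z) (hZ : P.map Z = gaussianReal 0 1)
    (m c y Rminus Rplus : ℝ) (hm : m ≠ 0) (hR : Rminus ≤ Rplus) :
    ∫ ω, (if Rminus < m * Z ω + c ∧ m * Z ω + c ≤ Rplus then y - (m * Z ω + c) else 0) ∂P
      = (y - c) * Real.sign m * (stdCDF ((Rplus - c) / m) - stdCDF ((Rminus - c) / m))
        - |m| * (stdM ((Rplus - c) / m) - stdM ((Rminus - c) / m)) := by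
  have hf : Measurable fun t : ℝ => y - (m * t + c) := by fun_prop
  rcases hm.lt_or_gt with hm | hm
  · have hr : (Rplus - c) / m ≤ (Rminus - c) / m :=
      div_le_div_of_nonpos_of_le hm.le (by linarith)
    calc
      _ = ∫ ω, (Set.Ico ((Rplus - c) / m) ((Rminus - c) / m)).indicator
            (fun t => y - (m * t + c)) (Z ω) ∂P := by
        congr 1
        ext ω
        simp only [Set.indicator_apply, Set.mem_Ico, div_le_iff_of_neg hm, lt_div_iff_of_neg hm]
        congr 1
        exact propext ⟨fun h => ⟨by linarith, by linarith⟩, fun h => ⟨by linarith, by linarith⟩⟩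
      _ = _ := by
        rw [integral_indicator_comp_of_map_eq_gaussianReal hZm hZ measurableSet_Ico hf,
          integral_Ico_eq_integral_Ioc, ← intervalIntegral.integral_of_le hr,
          intervalIntegral_stdPhi_mul_sub_affine, Real.sign_of_neg hm, abs_of_neg hm]
        ring
  · have hr : (Rminus - c) / m ≤ (Rplus - c) / m := by gcongr
    calc
      _ = ∫ ω, (Set.Ioc ((Rminus - c) / m) ((Rplus - c) / m)).indicator
            (fun t => y - (m * t + c)) (Z ω) ∂P := by
        congr 1
        ext ω
        simp only [Set.indicator_apply, Set.mem_Ioc, div_lt_iff₀ hm, le_div_iff₀ hm]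
        congr 1
        exact propext ⟨fun h => ⟨by linarith, by linarith⟩, fun h => ⟨by linarith, by linarith⟩⟩
      _ = _ := by
        rw [integral_indicator_comp_of_map_eq_gaussianReal hZm hZ measurableSet_Ioc hf,
          ← intervalIntegral.integral_of_le hr,
          intervalIntegral_stdPhi_mul_sub_affine, Real.sign_of_pos hm, abs_of_pos hm]
        ring
end

section
/- Fix N ≥ 1, finite index sets I and U, weights p_{i,u} ≥ 0, reals m_{i,u} ≠ 0 and c_u for i ∈ I, u ∈ U, and a standard normal random variable Z. On the open set {y ∈ ℝ^N : y₁ < y₂ < ⋯ < y_N} define the distortion D(y) := Σ_{i∈I} Σ_{u∈U} p_{i,u} · E[ min_{1 ≤ v ≤ N} (m_{i,u} Z + c_u − y_v)² ]. For each v define the region boundaries R_v^− := (y_{v−1} + y_v)/2 for v ≥ 2 with R₁^− := −∞, and R_v^+ := (y_v + y_{v+1})/2 for v ≤ N−1 with R_N^+ := +∞, and the standardized boundaries r_{i,u,v}^± := (R_v^± − c_u)/m_{i,u} (taking values in the extended reals, with the sign of an infinite boundary determined by the sign of m_{i,u}). Then D is partially differentiable in each coordinate at every such y, and for each 1 ≤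 v ≤ N, ∂D/∂y_v = 2 Σ_{i∈I} Σ_{u∈U} p_{i,u} [ (y_v − c_u) · sgn(m_{i,u}) · (F_Z(r_{i,u,v}^+) − F_Z(r_{i,u,v}^−)) − |m_{i,u}| · (M_Z(r_{i,u,v}^+) − M_Z(r_{i,u,v}^−)) ], where F_Z and M_Z are extended to ±∞ by F_Z(−∞) = 0, F_Z(+∞) = 1, M_Z(−∞) = 0, M_Z(+∞) = 0. -/
open MeasureTheory ProbabilityTheory

/-- `F_Z` extended to the extended reals by `F_Z(−∞) = 0`, `F_Z(+∞) = 1`. -/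
noncomputable def stdCDFE (x : EReal) : ℝ :=
  if x = ⊥ then 0 else if x = ⊤ then 1 else stdCDF x.toReal

/-- `M_Z` extended to the extended reals by `M_Z(±∞) = 0`. -/
noncomputable def stdME (x : EReal) : ℝ :=
  if x = ⊥ then 0 else if x = ⊤ then 0 else stdM x.toReal

/-- Upper region boundary `R_v^+ = (y_v + y_{v+1})/2`, with `R_N^+ = +∞`. -/
noncomputable def Rplus {N : ℕ} (y : Fin N → ℝ) (v : Fin N) : EReal :=
  if h : (v : ℕ) + 1 < N then (((y v + y ⟨(v : ℕ) + 1, h⟩) / 2 : ℝ) : EReal) else ⊤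

/-- Lower region boundary `R_v^− = (y_{v−1} + y_v)/2`, with `R_1^− = −∞`. -/
noncomputable def Rminus {N : ℕ} (y : Fin N → ℝ) (v : Fin N) : EReal :=
  if 0 < (v : ℕ) then
    (((y ⟨(v : ℕ) - 1, Nat.lt_of_le_of_lt (Nat.sub_le _ _) v.isLt⟩ + y v) / 2 : ℝ) : EReal)
  else ⊥

/-- Standardized boundary `r = (R − c)/m` in the extended reals, with the sign of an
infinite boundary determined by the sign of `m`. -/
noncomputable def stdBoundary (R : EReal) (c m : ℝ) : EReal :=
  if R = ⊤ then (if 0 < m then ⊤ else ⊥)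
  else if R = ⊥ then (if 0 < m then ⊥ else ⊤)
  else (((R.toReal - c) / m : ℝ) : EReal)

open Filter Topology

/-! ### Squared distance to a finite grid -/

/-- squared distance from `w` to the nearest point of the grid `y` -/
noncomputable def minSq {ι : Type*} (y : ι → ℝ) (w : ℝ) : ℝ := ⨅ j, (w - y j) ^ 2

section MinSq

variable {ι : Type*} (y : ι → ℝ) (w : ℝ)

lemma minSq_le (j : ι) : minSq y w ≤ (w - y j) ^ 2 :=
  ciInf_le ⟨0, by rintro _ ⟨j, rfl⟩; positivity⟩ j

lemma minSq_nonneg : 0 ≤ minSq y w := Real.iInf_nonneg fun _ => sq_nonneg _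

lemma measurable_minSq [Finite ι] : Measurable (minSq y) :=
  Measurable.iInf fun _ => by fun_prop

variable [DecidableEq ι] (v : ι)

lemma minSq_update_le_of_ne (t : ℝ) {j : ι} (hj : j ≠ v) :
    minSq (Function.update y v t) w ≤ (w - y j) ^ 2 := by
  simpa [hj] using minSq_le (Function.update y v t) w j

lemma minSq_update_le_self (t : ℝ) : minSq (Function.update y v t) w ≤ (w - t) ^ 2 := by
  simpa using minSq_le (Function.update y v t) w v

lemma le_minSq_update {t a : ℝ} (h : ∀ j ≠ v, a ≤ (w - y j) ^ 2) (hv : a ≤ (w - t) ^ 2) :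
    a ≤ minSq (Function.update y v t) w := by
  have : Nonempty ι := ⟨v⟩
  refine le_ciInf fun j => ?_
  by_cases hj : j = v
  · subst hj; simpa using hv
  · simpa [hj] using h j hj

lemma lipschitzOnWith_minSq_update :
    LipschitzOnWith (Real.nnabs (2 * (|w| + (|y v| + 1))))
      (fun t => minSq (Function.update y v t) w) (Metric.ball (y v) 1) := by
  have key : ∀ s ∈ Metric.ball (y v) 1, ∀ t ∈ Metric.ball (y v) 1,
      minSq (Function.update y v s) w - minSq (Function.update y v t) w
        ≤ 2 * (|w| + (|y v| + 1)) * |s - t| := by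
    intro s hs t ht
    rw [Metric.mem_ball, Real.dist_eq] at hs ht
    rw [sub_le_iff_le_add', ← sub_le_iff_le_add]
    refine le_minSq_update y w v (fun j hj => ?_) ?_
    · have := minSq_update_le_of_ne y w v s hj
      have : 0 ≤ 2 * (|w| + (|y v| + 1)) * |s - t| := by positivity
      linarith
    · have h1 := minSq_update_le_self y w v s
      have h2 : |s| ≤ |y v| + 1 := by
        have := abs_sub_abs_le_abs_sub s (y v); linarith
      have h3 : |t| ≤ |y v| + 1 := by
        have := abs_sub_abs_le_abs_sub t (y v); linarith
      have h4 : |s + t - 2 * w| ≤ 2 * (|w| + (|y v| + 1)) := by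
        rw [abs_le]
        constructor <;> linarith [abs_le.1 h2, abs_le.1 h3, neg_abs_le w, le_abs_self w]
      have h5 : (w - s) ^ 2 - (w - t) ^ 2 ≤ 2 * (|w| + (|y v| + 1)) * |s - t| := by
        calc (w - s) ^ 2 - (w - t) ^ 2 = (s + t - 2 * w) * (s - t) := by ring
          _ ≤ |s + t - 2 * w| * |s - t| := by rw [← abs_mul]; exact le_abs_self _
          _ ≤ _ := by gcongr
      linarith
  refine LipschitzOnWith.of_dist_le_mul fun s hs t ht => ?_
  rw [Real.dist_eq, Real.dist_eq, Real.coe_nnabs, abs_of_nonneg (a := 2 * (|w| + (|y v| + 1))) (by positivity),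
    abs_le]
  have h1 := key s hs t ht
  have h2 := key t ht s hs
  rw [abs_sub_comm t s] at h2
  constructor <;> linarith

/-- On the interior of the Voronoi cell of `y v` only the moving grid point matters. -/
lemma hasDerivAt_minSq_update_of_nearest [Finite ι]
    (h : ∀ j ≠ v, (w - y v) ^ 2 < (w - y j) ^ 2) :
    HasDerivAt (fun t => minSq (Function.update y v t) w) (2 * (y v - w)) (y v) := by
  have hd : HasDerivAt (fun t => (w - t) ^ 2) (2 * (y v - w)) (y v) := by
    refine (((hasDerivAt_id' (y v)).const_sub w).fun_pow 2).congr_deriv ?_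
    push_cast; ring
  refine hd.congr_of_eventuallyEq ?_
  have hev : ∀ᶠ t in 𝓝 (y v), ∀ j, j ≠ v → (w - t) ^ 2 < (w - y j) ^ 2 := by
    rw [eventually_all]
    intro j
    by_cases hj : j = v
    · simp [hj]
    · filter_upwards [hd.continuousAt.eventually_lt continuousAt_const (h j hj)] with t ht _
        using ht
  filter_upwards [hev] with t ht
  exact le_antisymm (minSq_update_le_self y w v t)
    (le_minSq_update y w v (fun j hj => (ht j hj).le) le_rfl)

/-- Outside the closed Voronoi cell of `y v` the distance does not depend on `y v` locally. -/
lemma hasDerivAt_minSq_update_of_not_nearest {j : ι} (h : (w - y j) ^ 2 < (w - y v) ^ 2) :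
    HasDerivAt (fun t => minSq (Function.update y v t) w) 0 (y v) := by
  have hj : j ≠ v := by rintro rfl; exact lt_irrefl _ h
  have hc : ContinuousAt (fun t => (w - t) ^ 2) (y v) := by fun_prop
  refine (hasDerivAt_const (y v) (minSq y w)).congr_of_eventuallyEq ?_
  filter_upwards [continuousAt_const.eventually_lt hc h] with t ht
  refine le_antisymm ?_ ?_
  · have : Nonempty ι := ⟨v⟩
    refine le_ciInf fun k => ?_
    by_cases hk : k = v
    · subst hk
      exact (minSq_update_le_of_ne y w k t hj).trans h.le
    · exact minSq_update_le_of_ne y w v t hk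
  · exact le_minSq_update y w v (fun k _ => minSq_le y w k) ((minSq_le y w j).trans ht.le)

end MinSq

/-! ### Voronoi cells of an increasing grid -/

section Voronoi

variable {N : ℕ} {y : Fin N → ℝ}

lemma Rminus_lt_Rplus (hy : StrictMono y) (v : Fin N) : Rminus y v < Rplus y v := by
  unfold Rminus Rplus
  split_ifs with h1 h2 h2
  · rw [EReal.coe_lt_coe_iff]
    have := hy (a := ⟨(v : ℕ) - 1, Nat.lt_of_le_of_lt (Nat.sub_le _ _) v.isLt⟩)
      (b := ⟨(v : ℕ) + 1, h2⟩) (by simp only [Fin.mk_lt_mk]; omega)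
    linarith
  · exact EReal.coe_lt_top _
  · exact EReal.bot_lt_coe _
  · exact bot_lt_top

lemma sq_lt_sq_of_mem_cell (hy : StrictMono y) {v : Fin N} {w : ℝ}
    (h1 : Rminus y v < w) (h2 : (w : EReal) < Rplus y v) {j : Fin N} (hj : j ≠ v) :
    (w - y v) ^ 2 < (w - y j) ^ 2 := by
  rcases lt_or_gt_of_ne hj with hlt | hgt
  · have hv : 0 < (v : ℕ) := by have := Fin.lt_def.1 hlt; omega
    rw [Rminus, if_pos hv, EReal.coe_lt_coe_iff] at h1
    have h3 : y j ≤ y ⟨(v : ℕ) - 1, Nat.lt_of_le_of_lt (Nat.sub_le _ _) v.isLt⟩ :=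
      hy.monotone (by rw [Fin.le_def]; have := Fin.lt_def.1 hlt; simp only; omega)
    nlinarith [hy hlt]
  · have hv : (v : ℕ) + 1 < N := by have := Fin.lt_def.1 hgt; omega
    rw [Rplus, dif_pos hv, EReal.coe_lt_coe_iff] at h2
    have h3 : y ⟨(v : ℕ) + 1, hv⟩ ≤ y j :=
      hy.monotone (by rw [Fin.le_def]; have := Fin.lt_def.1 hgt; simp only; omega)
    nlinarith [hy hgt]

lemma exists_sq_lt_sq_of_lt_Rminus (hy : StrictMono y) {v : Fin N} {w : ℝ}
    (h : (w : EReal) < Rminus y v) : ∃ j, (w - y j) ^ 2 < (w - y v) ^ 2 := by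
  unfold Rminus at h
  split_ifs at h with hv
  · rw [EReal.coe_lt_coe_iff] at h
    have h3 := hy (a := ⟨(v : ℕ) - 1, Nat.lt_of_le_of_lt (Nat.sub_le _ _) v.isLt⟩)
      (b := v) (by rw [Fin.lt_def]; simp only; omega)
    exact ⟨⟨(v : ℕ) - 1, Nat.lt_of_le_of_lt (Nat.sub_le _ _) v.isLt⟩, by nlinarith⟩
  · simp at h

lemma exists_sq_lt_sq_of_Rplus_lt (hy : StrictMono y) {v : Fin N} {w : ℝ}
    (h : Rplus y v < w) : ∃ j, (w - y j) ^ 2 < (w - y v) ^ 2 := by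
  unfold Rplus at h
  split_ifs at h with hv
  · rw [EReal.coe_lt_coe_iff] at h
    have h3 := hy (a := v) (b := ⟨(v : ℕ) + 1, hv⟩) (by rw [Fin.lt_def]; simp)
    exact ⟨⟨(v : ℕ) + 1, hv⟩, by nlinarith⟩
  · simp at h

/-- Gradient of the distortion of an increasing grid for a square integrable random variable
that does not charge the boundaries of the Voronoi cell. -/
lemma hasDerivAt_integral_minSq_update {Ω : Type*} [MeasurableSpace Ω] {P : Measure Ω}
    [IsFiniteMeasure P] {W : Ω → ℝ} (hWm : Measurable W) (hW : MemLp W 2 P)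
    (hy : StrictMono y) (v : Fin N)
    (hR : ∀ᵐ ω ∂P, (W ω : EReal) ≠ Rminus y v ∧ (W ω : EReal) ≠ Rplus y v) :
    HasDerivAt (fun t => ∫ ω, minSq (Function.update y v t) (W ω) ∂P)
      (∫ ω in {ω | Rminus y v < W ω ∧ (W ω : EReal) < Rplus y v}, 2 * (y v - W ω) ∂P)
      (y v) := by
  have hS : MeasurableSet {ω | Rminus y v < W ω ∧ (W ω : EReal) < Rplus y v} :=
    (measurableSet_lt measurable_const hWm.coe_real_ereal).inter
      (measurableSet_lt hWm.coe_real_ereal measurable_const)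
  rw [← integral_indicator hS]
  have hmeas : ∀ t, AEStronglyMeasurable (fun ω => minSq (Function.update y v t) (W ω)) P :=
    fun t => ((measurable_minSq _).comp hWm).aestronglyMeasurable
  refine (hasDerivAt_integral_of_dominated_loc_of_lip (Metric.ball_mem_nhds (y v) one_pos)
    (.of_forall hmeas) ?_ ?_ (.of_forall fun ω => lipschitzOnWith_minSq_update y (W ω) v)
    ?_ ?_).2
  · refine (hW.sub (memLp_const (y v))).integrable_sq.mono' (hmeas _) (.of_forall fun ω => ?_)
    rw [Real.norm_of_nonneg (minSq_nonneg _ _)]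
    exact minSq_update_le_self y (W ω) v (y v)
  · exact (Measurable.indicator (by fun_prop) hS).aestronglyMeasurable
  · exact (((hW.integrable one_le_two).abs.add (integrable_const _)).const_mul 2)
  · filter_upwards [hR] with ω hω
    by_cases h1 : Rminus y v < W ω
    · by_cases h2 : (W ω : EReal) < Rplus y v
      · rw [Set.indicator_of_mem (by exact ⟨h1, h2⟩)]
        exact hasDerivAt_minSq_update_of_nearest y (W ω) v
          fun j hj => sq_lt_sq_of_mem_cell hy h1 h2 hj
      · rw [Set.indicator_of_notMem (fun h => h2 h.2)]
        obtain ⟨j, hj⟩ := exists_sq_lt_sq_of_Rplus_lt hy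
          (lt_of_le_of_ne (not_lt.1 h2) hω.2.symm)
        exact hasDerivAt_minSq_update_of_not_nearest y (W ω) v hj
    · rw [Set.indicator_of_notMem (fun h => h1 h.1)]
      obtain ⟨j, hj⟩ := exists_sq_lt_sq_of_lt_Rminus hy (lt_of_le_of_ne (not_lt.1 h1) hω.1)
      exact hasDerivAt_minSq_update_of_not_nearest y (W ω) v hj

end Voronoi

/-! ### Lower partial moments of the standard normal distribution -/

instance nullSingletonClass_stdGaussian : NullSingletonClass (gaussianReal 0 1) :=
  nullSingletonClass_gaussianReal one_ne_zero

lemma gaussianPDFReal_zero_one_eq_stdPhi (t : ℝ) : gaussianPDFReal 0 1 t = stdPhi t := by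
  simp [gaussianPDFReal, stdPhi, div_eq_inv_mul]

lemma setIntegral_stdGaussian {s : Set ℝ} (hs : MeasurableSet s) (f : ℝ → ℝ) :
    ∫ z in s, f z ∂gaussianReal 0 1 = ∫ z in s, f z * stdPhi z := by
  rw [← integral_indicator hs, integral_gaussianReal_eq_integral_smul one_ne_zero,
    ← integral_indicator hs]
  refine integral_congr_ae (.of_forall fun z => ?_)
  by_cases hz : z ∈ s <;> simp [hz, gaussianPDFReal_zero_one_eq_stdPhi, mul_comm]

lemma setOf_coe_lt_coe (a : ℝ) : {z : ℝ | (z : EReal) < a} = Set.Iio a := by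
  ext; simp

lemma stdCDFE_eq_setIntegral (x : EReal) :
    stdCDFE x = ∫ _ in {z : ℝ | (z : EReal) < x}, (1 : ℝ) ∂gaussianReal 0 1 := by
  induction x with
  | bot => simp [stdCDFE]
  | top => simp [stdCDFE]
  | coe a =>
    rw [setOf_coe_lt_coe, setIntegral_stdGaussian measurableSet_Iio]
    simp [stdCDFE, stdCDF, integral_Iic_eq_integral_Iio]

lemma stdME_eq_setIntegral (x : EReal) :
    stdME x = ∫ z in {z : ℝ | (z : EReal) < x}, z ∂gaussianReal 0 1 := by
  induction x with
  | bot => simp [stdME]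
  | top => simp [stdME]
  | coe a =>
    rw [setOf_coe_lt_coe, setIntegral_stdGaussian measurableSet_Iio]
    simp [stdME, stdM]

/-! ### Standardized boundaries -/

lemma coe_lt_stdBoundary_iff_of_pos {R : EReal} {c m : ℝ} (hm : 0 < m) (z : ℝ) :
    (z : EReal) < stdBoundary R c m ↔ ((m * z + c : ℝ) : EReal) < R := by
  induction R with
  | bot => simp [stdBoundary, hm]
  | top => simp [stdBoundary, hm, -EReal.coe_add, -EReal.coe_mul, EReal.coe_lt_top]
  | coe a =>
    simp only [stdBoundary, EReal.coe_ne_top, EReal.coe_ne_bot, if_false, EReal.toReal_coe,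
      EReal.coe_lt_coe_iff, lt_div_iff₀ hm]
    constructor <;> intro h <;> linarith

lemma coe_lt_stdBoundary_iff_of_neg {R : EReal} {c m : ℝ} (hm : m < 0) (z : ℝ) :
    (z : EReal) < stdBoundary R c m ↔ R < ((m * z + c : ℝ) : EReal) := by
  induction R with
  | bot =>
    simp [stdBoundary, hm.not_gt, -EReal.coe_add, -EReal.coe_mul, EReal.coe_lt_top,
      EReal.bot_lt_coe]
  | top => simp [stdBoundary, hm.not_gt]
  | coe a =>
    simp only [stdBoundary, EReal.coe_ne_top, EReal.coe_ne_bot, if_false, EReal.toReal_coe,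
      EReal.coe_lt_coe_iff, lt_div_iff_of_neg hm]
    constructor <;> intro h <;> linarith

lemma ae_affine_ne {μ : Measure ℝ} [NullSingletonClass μ] {m : ℝ} (hm : m ≠ 0) (c : ℝ)
    (R : EReal) : ∀ᵐ z ∂μ, ((m * z + c : ℝ) : EReal) ≠ R := by
  induction R with
  | bot => exact .of_forall fun z => EReal.coe_ne_bot _
  | top => exact .of_forall fun z => EReal.coe_ne_top _
  | coe a =>
    filter_upwards [Measure.ae_ne μ ((a - c) / m)] with z hz h
    rw [EReal.coe_eq_coe_iff] at h
    exact hz (by rw [eq_div_iff hm]; linarith)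

/-- Integral over the preimage of `(a, b)` under an affine map, in terms of the standardized
boundaries. -/
lemma setIntegral_affine_mem {μ : Measure ℝ} [NullSingletonClass μ] {f : ℝ → ℝ}
    (hf : Integrable f μ) {m : ℝ} (hm : m ≠ 0) (c : ℝ) {a b : EReal} (hab : a < b) :
    ∫ z in {z : ℝ | a < ((m * z + c : ℝ) : EReal) ∧ ((m * z + c : ℝ) : EReal) < b}, f z ∂μ
      = Real.sign m * (∫ z in {z : ℝ | (z : EReal) < stdBoundary b c m}, f z ∂μ
          - ∫ z in {z : ℝ | (z : EReal) < stdBoundary a c m}, f z ∂μ) := by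
  have hmeas : ∀ x : EReal, MeasurableSet {z : ℝ | (z : EReal) < x} := fun x =>
    measurableSet_lt measurable_coe_real_ereal measurable_const
  rcases hm.lt_or_gt with hneg | hpos
  · rw [Real.sign_of_neg hneg, neg_one_mul, neg_sub,
      ← setIntegral_sdiff (hmeas _) hf.integrableOn]
    · refine setIntegral_congr_set ?_
      filter_upwards [ae_affine_ne hm c b] with z hz
      refine propext ?_
      change (_ ∧ _) ↔ (_ ∧ ¬ _)
      simp only [Set.mem_ofPred_eq, coe_lt_stdBoundary_iff_of_neg hneg, not_lt]
      exact and_congr_right fun _ => ⟨le_of_lt, fun h => lt_of_le_of_ne h hz⟩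
    · intro z
      simp only [Set.mem_ofPred_eq, coe_lt_stdBoundary_iff_of_neg hneg]
      exact hab.trans
  · rw [Real.sign_of_pos hpos, one_mul, ← setIntegral_sdiff (hmeas _) hf.integrableOn]
    · refine setIntegral_congr_set ?_
      filter_upwards [ae_affine_ne hm c a] with z hz
      refine propext ?_
      change (_ ∧ _) ↔ (_ ∧ ¬ _)
      simp only [Set.mem_ofPred_eq, coe_lt_stdBoundary_iff_of_pos hpos, not_lt]
      exact and_comm.trans
        (and_congr_right fun _ => ⟨le_of_lt, fun h => lt_of_le_of_ne h hz.symm⟩)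
    · intro z
      simp only [Set.mem_ofPred_eq, coe_lt_stdBoundary_iff_of_pos hpos]
      exact fun h => h.trans hab

/-- Gradient of the distortion of an increasing grid for the normal variable `m Z + c`. -/
lemma hasDerivAt_integral_minSq_stdGaussian {N : ℕ} {y : Fin N → ℝ} (hy : StrictMono y)
    (v : Fin N) {m : ℝ} (hm : m ≠ 0) (c : ℝ) :
    HasDerivAt (fun t => ∫ z, minSq (Function.update y v t) (m * z + c) ∂gaussianReal 0 1)
      (2 * ((y v - c) * Real.sign m *
          (stdCDFE (stdBoundary (Rplus y v) c m) - stdCDFE (stdBoundary (Rminus y v) c m))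
        - |m| * (stdME (stdBoundary (Rplus y v) c m) - stdME (stdBoundary (Rminus y v) c m))))
      (y v) := by
  have hid : MemLp (fun z : ℝ => z) 2 (gaussianReal 0 1) := by
    exact_mod_cast memLp_id_gaussianReal (μ := 0) (v := 1) 2
  have hint : Integrable (fun z : ℝ => z) (gaussianReal 0 1) := hid.integrable one_le_two
  have hW : MemLp (fun z : ℝ => m * z + c) 2 (gaussianReal 0 1) :=
    (hid.const_mul m).add (memLp_const c)
  convert hasDerivAt_integral_minSq_update (by fun_prop) hW hy v
    ((ae_affine_ne hm c _).and (ae_affine_ne hm c _)) using 1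
  have hsplit : (fun z : ℝ => 2 * (y v - (m * z + c)))
      = fun z => 2 * (y v - c) * 1 - 2 * m * z := by
    funext z; ring
  have hsign : Real.sign m * m = |m| := by
    rcases hm.lt_or_gt with h | h
    · rw [Real.sign_of_neg h, abs_of_neg h]; ring
    · rw [Real.sign_of_pos h, abs_of_pos h]; ring
  rw [hsplit, integral_sub ((integrable_const _).const_mul _).restrict
      (hint.const_mul _).restrict, integral_const_mul, integral_const_mul,
    setIntegral_affine_mem (integrable_const _) hm c (Rminus_lt_Rplus hy v),
    setIntegral_affine_mem hint hm c (Rminus_lt_Rplus hy v),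
    ← stdCDFE_eq_setIntegral, ← stdCDFE_eq_setIntegral, ← stdME_eq_setIntegral,
    ← stdME_eq_setIntegral, ← hsign]
  ring

/-- **Gradient of the JRMQ distortion (Eq. SV Gradient).** On the open set of strictly
increasing grids, the distortion
`D(y) = Σ_{i,u} p_{i,u} E[min_v (m_{i,u}Z + c_u − y_v)²]`
is partially differentiable in each coordinate and
`∂D/∂y_v = 2 Σ_{i,u} p_{i,u} [(y_v − c_u) sgn(m_{i,u}) (F_Z(r⁺) − F_Z(r⁻))
  − |m_{i,u}| (M_Z(r⁺) − M_Z(r⁻))]`. -/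
theorem jrmq_distortion_gradient
    {Ω : Type*} [MeasurableSpace Ω] (P : Measure Ω) [IsProbabilityMeasure P]
    (Z : Ω → ℝ) (hZm : Measurable Z) (hZ : P.map Z = gaussianReal 0 1)
    {I U : Type*} [Fintype I] [Fintype U]
    (N : ℕ) (hN : 1 ≤ N)
    (p : I → U → ℝ) (hp : ∀ i u, 0 ≤ p i u)
    (m : I → U → ℝ) (hm : ∀ i u, m i u ≠ 0)
    (c : U → ℝ)
    (D : (Fin N → ℝ) → ℝ)
    (hD : ∀ y : Fin N → ℝ,
      D y = ∑ i : I, ∑ u : U,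
        p i u * ∫ ω, (⨅ v : Fin N, (m i u * Z ω + c u - y v) ^ 2) ∂P)
    (y : Fin N → ℝ) (hy : StrictMono y) (v : Fin N) :
    HasDerivAt (fun t => D (Function.update y v t))
      (2 * ∑ i : I, ∑ u : U, p i u *
        ((y v - c u) * Real.sign (m i u) *
            (stdCDFE (stdBoundary (Rplus y v) (c u) (m i u))
              - stdCDFE (stdBoundary (Rminus y v) (c u) (m i u)))
          - |m i u| *
            (stdME (stdBoundary (Rplus y v) (c u) (m i u))
              - stdME (stdBoundary (Rminus y v) (c u) (m i u)))))
      (y v) := by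
  have hlaw : ∀ (x : Fin N → ℝ) i u,
      ∫ ω, (⨅ w : Fin N, (m i u * Z ω + c u - x w) ^ 2) ∂P
        = ∫ z, minSq x (m i u * z + c u) ∂gaussianReal 0 1 := by
    intro x i u
    have hmeas : Measurable fun z => minSq x (m i u * z + c u) :=
      (measurable_minSq x).comp (by fun_prop)
    rw [← hZ, integral_map hZm.aemeasurable hmeas.aestronglyMeasurable]
    rfl
  simp only [hD, hlaw, Finset.mul_sum]
  refine HasDerivAt.fun_sum fun i _ => HasDerivAt.fun_sum fun u _ => ?_
  rw [mul_left_comm]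
  exact (hasDerivAt_integral_minSq_stdGaussian hy v (hm i u) (c u)).const_mul (p i u)
end

section
/- In the setting of the distortion D(y) := Σ_{i∈I} Σ_{u∈U} p_{i,u} · E[ min_{1 ≤ v ≤ N} (m_{i,u} Z + c_u − y_v)² ] on {y ∈ ℝ^N : y₁ < ⋯ < y_N}, with standardized boundaries r_{i,u,v}^+ = ((y_v + y_{v+1})/2 − c_u)/m_{i,u}, the off-diagonal Hessian entries are, for each 1 ≤ v ≤ N − 1: ∂²D/∂y_v ∂y_{v+1} = Σ_{i∈I} Σ_{u∈U} p_{i,u} · (1/(2|m_{i,u}|)) · φ(r_{i,u,v}^+) · (y_v − y_{v+1}), and all Hessian entries ∂²D/∂y_v ∂y_w with |v − w| ≥ 2 vanish, so the Hessian matrix of D is tridiagonal. -/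
open MeasureTheory ProbabilityTheory

/-- `φ` extended to the extended reals by `φ(±∞) = 0`. -/
noncomputable def stdPhiE (x : EReal) : ℝ :=
  if x = ⊥ then 0 else if x = ⊤ then 0 else stdPhi x.toReal

section

open Filter Topology Set

/-- The open nearest-neighbour cell of the grid point `y v`. -/
def voronoiCell {ι : Type*} (y : ι → ℝ) (v : ι) : Set ℝ :=
  {x | ∀ w, w ≠ v → (x - y v) ^ 2 < (x - y w) ^ 2}

lemma isOpen_voronoiCell {ι : Type*} [Finite ι] (y : ι → ℝ) (v : ι) :
    IsOpen (voronoiCell y v) := by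
  simp only [voronoiCell, ofPred_forall]
  exact isOpen_iInter_of_finite fun w => isOpen_iInter_of_finite fun _ =>
    isOpen_lt (by fun_prop) (by fun_prop)

lemma iInf_eq_of_forall_le_apply {ι : Type*} [Finite ι] {f : ι → ℝ} (a : ι)
    (h : ∀ w, f a ≤ f w) : ⨅ w, f w = f a :=
  have : Nonempty ι := ⟨a⟩
  le_antisymm (ciInf_le (finite_range f).bddBelow a) (le_ciInf h)

lemma abs_iInf_sub_iInf_le {ι : Type*} [Finite ι] [Nonempty ι] {f g : ι → ℝ} {K : ℝ}
    (h : ∀ w, |f w - g w| ≤ K) : |(⨅ w, f w) - ⨅ w, g w| ≤ K := by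
  have key : ∀ f g : ι → ℝ, (∀ w, f w ≤ g w + K) → (⨅ w, f w) - K ≤ ⨅ w, g w :=
    fun f g h => le_ciInf fun w => by
      linarith [h w, ciInf_le (finite_range f).bddBelow w]
  have h1 := key f g fun w => by linarith [(abs_le.1 (h w)).2]
  have h2 := key g f fun w => by linarith [(abs_le.1 (h w)).1]
  exact abs_le.2 ⟨by linarith, by linarith⟩

lemma hasDerivAt_iInf_sq {ι : Type*} [Finite ι] [DecidableEq ι] {y : ι → ℝ} (v : ι) {x : ℝ}
    (hx : ∀ w, w ≠ v → (x - y w) ^ 2 ≠ (x - y v) ^ 2) :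
    HasDerivAt (fun t => ⨅ w, (x - Function.update y v t w) ^ 2)
      ((voronoiCell y v).indicator (fun x => 2 * (y v - x)) x) (y v) := by
  have : Nonempty ι := ⟨v⟩
  have hcont : Continuous fun t : ℝ => (x - t) ^ 2 := by fun_prop
  obtain ⟨a, ha⟩ := Finite.exists_min fun w => (x - y w) ^ 2
  by_cases hav : a = v
  · subst hav
    have hmem : x ∈ voronoiCell y a := fun w hw => lt_of_le_of_ne (ha w) (hx w hw).symm
    rw [indicator_of_mem hmem]
    have hd : HasDerivAt (fun t : ℝ => (x - t) ^ 2) (2 * (y a - x)) (y a) := by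
      have h := ((hasDerivAt_id' (y a)).const_sub x).fun_pow 2
      exact h.congr_deriv (by ring)
    refine hd.congr_of_eventuallyEq ?_
    have hev : ∀ᶠ t in 𝓝 (y a), ∀ w, w ≠ a → (x - t) ^ 2 < (x - y w) ^ 2 :=
      eventually_all.2 fun w => eventually_imp_distrib_left.2 fun hw =>
        hcont.continuousAt.eventually_lt continuousAt_const (hmem w hw)
    filter_upwards [hev] with t ht
    rw [iInf_eq_of_forall_le_apply a]
    · simp
    · intro w
      by_cases hw : w = a
      · rw [hw]
      · simpa [hw] using (ht w hw).le
  · have hlt : (x - y a) ^ 2 < (x - y v) ^ 2 := lt_of_le_of_ne (ha v) (hx a hav)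
    have hmem : x ∉ voronoiCell y v := fun h => lt_asymm (h a hav) hlt
    rw [indicator_of_notMem hmem]
    refine (hasDerivAt_const (y v) ((x - y a) ^ 2)).congr_of_eventuallyEq ?_
    filter_upwards [(continuousAt_const (y := (x - y a) ^ 2)).eventually_lt
      hcont.continuousAt hlt] with t ht
    rw [iInf_eq_of_forall_le_apply a]
    · simp [hav]
    · intro w
      by_cases hw : w = v
      · subst hw
        simpa [hav] using ht.le
      · simpa [hw, hav] using ha w

lemma abs_iInf_sq_update_sub_le {ι : Type*} [Finite ι] [DecidableEq ι] (y : ι → ℝ) (v : ι)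
    (x : ℝ) {s t : ℝ} (hs : |s - y v| ≤ 1) (ht : |t - y v| ≤ 1) :
    |(⨅ w, (x - Function.update y v s w) ^ 2) - ⨅ w, (x - Function.update y v t w) ^ 2| ≤
      (2 * |x - y v| + 2) * |s - t| := by
  have : Nonempty ι := ⟨v⟩
  refine abs_iInf_sub_iInf_le fun w => ?_
  by_cases hw : w = v
  · subst hw
    simp only [Function.update_self]
    have : (x - s) ^ 2 - (x - t) ^ 2 = (2 * (x - y w) - (s - y w) - (t - y w)) * -(s - t) := by ring
    rw [this, abs_mul, abs_neg]
    gcongr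
    calc _ ≤ |2 * (x - y w) - (s - y w)| + |t - y w| := abs_sub _ _
      _ ≤ |2 * (x - y w)| + |s - y w| + |t - y w| := by gcongr; exact abs_sub _ _
      _ ≤ _ := by rw [abs_mul, abs_two]; linarith
  · simp only [Function.update_of_ne hw, sub_self, abs_zero]
    positivity

theorem hasDerivAt_integral_iInf_sq {ι : Type*} [Finite ι] [DecidableEq ι] {μ : Measure ℝ}
    [IsFiniteMeasure μ] [NullSingletonClass μ] (hμ : MemLp id 2 μ) {y : ι → ℝ}
    (hy : Function.Injective y) (v : ι) :
    HasDerivAt (fun t => ∫ x, ⨅ w, (x - Function.update y v t w) ^ 2 ∂μ)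
      (∫ x in voronoiCell y v, 2 * (y v - x) ∂μ) (y v) := by
  have : Nonempty ι := ⟨v⟩
  have hmeas : ∀ z : ι → ℝ, Measurable fun x : ℝ => ⨅ w, (x - z w) ^ 2 := fun z =>
    Measurable.iInf fun w => by fun_prop
  have hcell : MeasurableSet (voronoiCell y v) := (isOpen_voronoiCell y v).measurableSet
  have hsub : MemLp (fun x : ℝ => x - y v) 2 μ := hμ.sub (memLp_const (y v))
  rw [← integral_indicator hcell]
  refine (hasDerivAt_integral_of_dominated_loc_of_lip
    (bound := fun x => 2 * |x - y v| + 2) (Metric.closedBall_mem_nhds (y v) one_pos)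
    (Eventually.of_forall fun t => (hmeas _).aestronglyMeasurable) ?_ ?_ ?_ ?_ ?_).2
  · refine hsub.integrable_sq.mono' (hmeas _).aestronglyMeasurable (ae_of_all _ fun x => ?_)
    rw [Real.norm_of_nonneg (Real.iInf_nonneg fun w => sq_nonneg _)]
    exact (ciInf_le (finite_range _).bddBelow v).trans (by simp)
  · exact (Measurable.indicator (by fun_prop) hcell).aestronglyMeasurable
  · refine ae_of_all _ fun x => LipschitzOnWith.of_dist_le_mul fun s hs t ht => ?_
    rw [Real.dist_eq, Real.dist_eq, Real.coe_nnabs,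
      abs_of_nonneg (a := 2 * |x - y v| + 2) (by positivity)]
    exact abs_iInf_sq_update_sub_le y v x hs ht
  · exact ((hsub.integrable (by norm_num)).abs.const_mul 2).add (integrable_const 2)
  · filter_upwards [(finite_range fun w => (y v + y w) / 2).countable.ae_notMem μ] with x hx
    refine hasDerivAt_iInf_sq v fun w hw h => hx ⟨w, ?_⟩
    rcases sq_eq_sq_iff_eq_or_eq_neg.1 h with h | h
    · exact absurd (hy (by linarith)) hw
    · dsimp only; linarith

lemma sub_sq_lt_sub_sq_iff {x a b : ℝ} (hab : a < b) :
    (x - a) ^ 2 < (x - b) ^ 2 ↔ 2 * x < a + b := by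
  constructor <;> intro h <;> nlinarith

lemma sub_sq_lt_sub_sq_iff' {x a b : ℝ} (hab : a < b) :
    (x - b) ^ 2 < (x - a) ^ 2 ↔ a + b < 2 * x := by
  constructor <;> intro h <;> nlinarith

/-- The cells of an ordered grid are determined by the adjacent grid points. -/
lemma mem_voronoiCell_iff {N : ℕ} {y : Fin N → ℝ} (hy : StrictMono y) {v : Fin N} {x : ℝ} :
    x ∈ voronoiCell y v ↔ (∀ u : Fin N, (u : ℕ) + 1 = v → y u + y v < 2 * x) ∧
      ∀ u : Fin N, (u : ℕ) = v + 1 → 2 * x < y v + y u := by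
  constructor
  · refine fun h => ⟨fun u hu => ?_, fun u hu => ?_⟩
    · have huv : u < v := by rw [Fin.lt_def]; omega
      exact (sub_sq_lt_sub_sq_iff' (hy huv)).1 (h u huv.ne)
    · have huv : v < u := by rw [Fin.lt_def]; omega
      exact (sub_sq_lt_sub_sq_iff (hy huv)).1 (h u huv.ne')
  · rintro ⟨h1, h2⟩ w hw
    rcases lt_or_gt_of_ne hw with hlt | hlt
    · rw [sub_sq_lt_sub_sq_iff' (hy hlt)]
      rw [Fin.lt_def] at hlt
      have hle : w ≤ ⟨v - 1, by omega⟩ := by rw [Fin.le_def]; dsimp only; omega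
      have := hy.monotone hle
      have := h1 ⟨v - 1, by omega⟩ (by dsimp only; omega)
      linarith
    · rw [sub_sq_lt_sub_sq_iff (hy hlt)]
      rw [Fin.lt_def] at hlt
      have hle : ⟨v + 1, by omega⟩ ≤ w := by rw [Fin.le_def]; dsimp only; omega
      have := hy.monotone hle
      have := h2 ⟨v + 1, by omega⟩ rfl
      linarith

lemma eventually_strictMono_update {N : ℕ} {y : Fin N → ℝ} (hy : StrictMono y) (w : Fin N) :
    ∀ᶠ s in 𝓝 (y w), StrictMono (Function.update y w s) := by
  have hcont : Continuous fun s => Function.update y w s := by fun_prop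
  have key : ∀ᶠ s in 𝓝 (y w), ∀ a b : Fin N, a < b →
      Function.update y w s a < Function.update y w s b :=
    eventually_all.2 fun a => eventually_all.2 fun b => eventually_imp_distrib_left.2 fun hab =>
      ((continuous_apply a).comp hcont).continuousAt.eventually_lt
        ((continuous_apply b).comp hcont).continuousAt (by simpa using hy hab)
  exact key.mono fun s hs a b hab => hs a b hab

lemma hasDerivAt_integral_Iio {g : ℝ → ℝ} {b : ℝ} (hg : Integrable g) (hb : ContinuousAt g b) :
    HasDerivAt (fun s => ∫ x in Iio s, g x) (g b) b := by
  have h := (intervalIntegral.integral_hasDerivAt_right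
    (hg.intervalIntegrable (a := b) (b := b))
    hg.aestronglyMeasurable.stronglyMeasurableAtFilter hb).const_add (∫ x in Iic b, g x)
  refine h.congr_of_eventuallyEq (Eventually.of_forall fun s => ?_)
  dsimp only
  rw [← intervalIntegral.integral_Iic_sub_Iic hg.integrableOn hg.integrableOn,
    integral_Iic_eq_integral_Iio (x := s)]
  ring

lemma continuous_gaussianPDFReal (c : ℝ) (V : NNReal) : Continuous (gaussianPDFReal c V) := by
  rw [gaussianPDFReal_def]
  fun_prop

lemma hasDerivAt_setIntegral_voronoiCell {N : ℕ} {c : ℝ} {V : NNReal} (hV : V ≠ 0)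
    {y : Fin N → ℝ} (hy : StrictMono y) {v w : Fin N} (hvw : (w : ℕ) = v + 1) :
    HasDerivAt (fun s => ∫ x in voronoiCell (Function.update y w s) v,
        2 * (y v - x) ∂(gaussianReal c V))
      (gaussianPDFReal c V ((y v + y w) / 2) * (y v - y w) / 2) (y w) := by
  have hlt : v < w := by rw [Fin.lt_def]; omega
  set B : Set ℝ := {x | ∀ u : Fin N, (u : ℕ) + 1 = v → y u + y v < 2 * x}
  have hBo : IsOpen B := by
    simp only [B, ofPred_forall]
    exact isOpen_iInter_of_finite fun w => isOpen_iInter_of_finite fun _ =>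
      isOpen_lt (by fun_prop) (by fun_prop)
  have hB : (y v + y w) / 2 ∈ B := fun u hu => by
    have huv : u < v := by rw [Fin.lt_def]; omega
    linarith [hy huv, hy hlt]
  set f : ℝ → ℝ := fun x => gaussianPDFReal c V x * (2 * (y v - x))
  have hf : Integrable f := by
    have h : Integrable (fun x : ℝ => 2 * (y v - x)) (gaussianReal c V) :=
      ((integrable_const (y v)).sub ((memLp_id_gaussianReal 1).integrable le_rfl)).const_mul 2
    rw [gaussianReal_of_var_ne_zero _ hV, integrable_withDensity_iff_integrable_smul'
      (measurable_gaussianPDF _ _) (ae_of_all _ fun _ => gaussianPDF_lt_top)] at h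
    simpa [f, toReal_gaussianPDF] using h
  have hfc : Continuous f := (continuous_gaussianPDFReal c V).mul (by fun_prop)
  have hg : Integrable (B.indicator f) := hf.indicator hBo.measurableSet
  have hgR : B.indicator f =ᶠ[𝓝 ((y v + y w) / 2)] f :=
    (hBo.eventually_mem hB).mono fun x hx => indicator_of_mem hx f
  have h1 := hasDerivAt_integral_Iio hg (hfc.continuousAt.congr hgR.symm)
  have h2 : HasDerivAt (fun s => (y v + s) / 2) (1 / 2) (y w) :=
    ((hasDerivAt_id _).const_add _).div_const 2
  have h3 := h1.comp (y w) h2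
  rw [hgR.eq_of_nhds] at h3
  refine (h3.congr_deriv (by simp only [f]; ring)).congr_of_eventuallyEq ?_
  filter_upwards [eventually_strictMono_update hy w] with s hs
  have hset : voronoiCell (Function.update y w s) v = Iio ((y v + s) / 2) ∩ B := by
    ext x
    rw [mem_voronoiCell_iff hs, and_comm]
    refine and_congr ⟨fun h => ?_, fun h u hu => ?_⟩ (forall_congr' fun u => ?_)
    · have := h w hvw
      rw [Function.update_self, Function.update_of_ne hlt.ne] at this
      rw [mem_Iio]; linarith
    · obtain rfl : u = w := Fin.ext (hu.trans hvw.symm)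
      rw [Function.update_self, Function.update_of_ne hlt.ne]
      rw [mem_Iio] at h; linarith
    · refine imp_congr_right fun hu => ?_
      have huw : u ≠ w := fun h => by rw [h] at hu; omega
      rw [Function.update_of_ne huw, Function.update_of_ne hlt.ne]
  have hm : MeasurableSet (Iio ((y v + s) / 2) ∩ B) := measurableSet_Iio.inter hBo.measurableSet
  rw [hset, ← integral_indicator hm, integral_gaussianReal_eq_integral_smul hV,
    Function.comp_apply, ← integral_indicator measurableSet_Iio, indicator_indicator]
  congr 1
  ext x
  by_cases hx : x ∈ Iio ((y v + s) / 2) ∩ B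
  · simp [indicator_of_mem hx, f]
  · simp [indicator_of_notMem hx]

lemma hasDerivAt_setIntegral_voronoiCell_of_not_adjacent {N : ℕ} (μ : Measure ℝ)
    {y : Fin N → ℝ} (hy : StrictMono y) {v w : Fin N} (hvw : 2 ≤ ((v : ℤ) - (w : ℤ)).natAbs)
    (g : ℝ → ℝ) :
    HasDerivAt (fun s => ∫ x in voronoiCell (Function.update y w s) v, g x ∂μ) 0 (y w) := by
  refine (hasDerivAt_const (y w) (∫ x in voronoiCell y v, g x ∂μ)).congr_of_eventuallyEq ?_
  filter_upwards [eventually_strictMono_update hy w] with s hs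
  have hv : v ≠ w := fun h => by rw [h] at hvw; omega
  have hset : voronoiCell (Function.update y w s) v = voronoiCell y v := by
    ext x
    rw [mem_voronoiCell_iff hs, mem_voronoiCell_iff hy]
    refine and_congr (forall_congr' fun u => imp_congr_right fun hu => ?_)
      (forall_congr' fun u => imp_congr_right fun hu => ?_) <;>
    · have huw : u ≠ w := fun h => by rw [h] at hu; omega
      rw [Function.update_of_ne huw, Function.update_of_ne hv]
  rw [hset]

lemma map_mul_add_eq_gaussianReal {Ω : Type*} [MeasurableSpace Ω] {P : Measure Ω} {Z : Ω → ℝ}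
    (hZm : Measurable Z) (hZ : P.map Z = gaussianReal 0 1) (a c : ℝ) :
    P.map (fun ω => a * Z ω + c) = gaussianReal c (.mk (a ^ 2) (sq_nonneg a)) := by
  have h : (fun ω => a * Z ω + c) = (· + c) ∘ (a * ·) ∘ Z := rfl
  rw [h, ← Measure.map_map (by fun_prop) (by fun_prop), ← Measure.map_map (by fun_prop) hZm, hZ,
    gaussianReal_map_const_mul, gaussianReal_map_add_const]
  simp

lemma gaussianPDFReal_eq_stdPhi {a : ℝ} (ha : a ≠ 0) (c x : ℝ) :
    gaussianPDFReal c (.mk (a ^ 2) (sq_nonneg a)) x = stdPhi ((x - c) / a) / |a| := by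
  rw [gaussianPDFReal, stdPhi, NNReal.coe_mk, Real.sqrt_mul (by positivity), Real.sqrt_sq_eq_abs,
    show -(x - c) ^ 2 / (2 * a ^ 2) = -((x - c) / a) ^ 2 / 2 by field_simp]
  have : |a| ≠ 0 := abs_ne_zero.2 ha
  field_simp

lemma stdPhiE_stdBoundary_Rplus {N : ℕ} (y : Fin N → ℝ) {v w : Fin N} (hvw : (w : ℕ) = v + 1)
    (c a : ℝ) :
    stdPhiE (stdBoundary (Rplus y v) c a) = stdPhi (((y v + y w) / 2 - c) / a) := by
  have h : (v : ℕ) + 1 < N := hvw ▸ w.2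
  obtain rfl : w = ⟨v + 1, h⟩ := Fin.ext hvw
  rw [Rplus, dif_pos h, stdBoundary, if_neg (EReal.coe_ne_top _), if_neg (EReal.coe_ne_bot _),
    stdPhiE, if_neg (EReal.coe_ne_bot _), if_neg (EReal.coe_ne_top _), EReal.toReal_coe,
    EReal.toReal_coe]

end

/-- **Off-diagonal Hessian entries of the JRMQ distortion: the Hessian is tridiagonal.**
For the distortion `D(y) = Σ_{i,u} p_{i,u} E[min_v (m_{i,u}Z + c_u − y_v)²]` on the open
set of strictly increasing grids:
`∂²D/∂y_v∂y_{v+1} = Σ_{i,u} p_{i,u} (1/(2|m_{i,u}|)) φ(r_{i,u,v}⁺) (y_v − y_{v+1})`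
(where `r_{i,u,v}⁺ = ((y_v + y_{v+1})/2 − c_u)/m_{i,u}`), and all mixed partials
`∂²D/∂y_v∂y_w` with `|v − w| ≥ 2` vanish. -/
theorem jrmq_distortion_hessian_offdiagonal
    {Ω : Type*} [MeasurableSpace Ω] (P : Measure Ω) [IsProbabilityMeasure P]
    (Z : Ω → ℝ) (hZm : Measurable Z) (hZ : P.map Z = gaussianReal 0 1)
    {I U : Type*} [Fintype I] [Fintype U]
    (N : ℕ) (hN : 1 ≤ N)
    (p : I → U → ℝ) (hp : ∀ i u, 0 ≤ p i u)
    (m : I → U → ℝ) (hm : ∀ i u, m i u ≠ 0)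
    (c : U → ℝ)
    (D : (Fin N → ℝ) → ℝ)
    (hD : ∀ y : Fin N → ℝ,
      D y = ∑ i : I, ∑ u : U,
        p i u * ∫ ω, (⨅ v : Fin N, (m i u * Z ω + c u - y v) ^ 2) ∂P)
    (y : Fin N → ℝ) (hy : StrictMono y) :
    (∀ v w : Fin N, (w : ℕ) = (v : ℕ) + 1 →
      HasDerivAt
        (fun s => deriv (fun t => D (Function.update (Function.update y w s) v t))
          ((Function.update y w s) v))
        (∑ i : I, ∑ u : U, p i u * (1 / (2 * |m i u|)) *
          stdPhiE (stdBoundary (Rplus y v) (c u) (m i u)) * (y v - y w))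
        (y w))
    ∧ (∀ v w : Fin N, 2 ≤ ((v : ℤ) - (w : ℤ)).natAbs →
      HasDerivAt
        (fun s => deriv (fun t => D (Function.update (Function.update y w s) v t))
          ((Function.update y w s) v))
        0
        (y w)) := by
  have hV : ∀ i u, NNReal.mk (m i u ^ 2) (sq_nonneg _) ≠ 0 := fun i u h =>
    pow_ne_zero 2 (hm i u) (congrArg NNReal.toReal h)
  have hD' : ∀ z : Fin N → ℝ, D z = ∑ i : I, ∑ u : U, p i u *
      ∫ x, (⨅ v : Fin N, (x - z v) ^ 2) ∂(gaussianReal (c u) (.mk (m i u ^ 2) (sq_nonneg _))) := by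
    intro z
    have : Nonempty (Fin N) := ⟨⟨0, hN⟩⟩
    rw [hD]
    refine Finset.sum_congr rfl fun i _ => Finset.sum_congr rfl fun u _ => ?_
    rw [← map_mul_add_eq_gaussianReal hZm hZ, integral_map (by fun_prop)
      (Measurable.iInf fun w => by fun_prop).aestronglyMeasurable]
  have hgrad : ∀ v w : Fin N, v ≠ w →
      (fun s => deriv (fun t => D (Function.update (Function.update y w s) v t))
          ((Function.update y w s) v)) =ᶠ[nhds (y w)]
      fun s => ∑ i : I, ∑ u : U, p i u * ∫ x in voronoiCell (Function.update y w s) v,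
        2 * (y v - x) ∂(gaussianReal (c u) (.mk (m i u ^ 2) (sq_nonneg _))) := by
    intro v w hvw
    filter_upwards [eventually_strictMono_update hy w] with s hs
    simp_rw [hD']
    refine (HasDerivAt.fun_sum fun i _ => HasDerivAt.fun_sum fun u _ =>
      HasDerivAt.const_mul (p i u) ?_).deriv
    have := nullSingletonClass_gaussianReal (μ := c u) (hV i u)
    have := hasDerivAt_integral_iInf_sq (μ := gaussianReal (c u) (.mk (m i u ^ 2) (sq_nonneg _)))
      (memLp_id_gaussianReal 2) hs.injective v
    rwa [Function.update_of_ne hvw s y] at this ⊢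
  refine ⟨fun v w hvw => ?_, fun v w hvw => ?_⟩
  · have hne : v ≠ w := fun h => by rw [h] at hvw; omega
    refine HasDerivAt.congr_of_eventuallyEq ?_ (hgrad v w hne)
    refine HasDerivAt.fun_sum fun i _ => HasDerivAt.fun_sum fun u _ => ?_
    refine ((hasDerivAt_setIntegral_voronoiCell (hV i u) hy hvw).const_mul (p i u)).congr_deriv ?_
    rw [gaussianPDFReal_eq_stdPhi (hm i u), stdPhiE_stdBoundary_Rplus y hvw]
    have : |m i u| ≠ 0 := abs_ne_zero.2 (hm i u)
    field_simp
  · have hne : v ≠ w := fun h => by rw [h] at hvw; omega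
    refine HasDerivAt.congr_of_eventuallyEq ?_ (hgrad v w hne)
    refine (HasDerivAt.fun_sum fun i _ => HasDerivAt.fun_sum fun u _ =>
      (hasDerivAt_setIntegral_voronoiCell_of_not_adjacent _ hy hvw _).const_mul
        (p i u)).congr_deriv ?_
    simp
end
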